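/- Let k be a nonzero integer and let c_1, …, c_n, c'_1, …, c'_{n'} be integers such that all n + n' of them are pairwise distinct. Assume that for every prime p there exists an integer a_p such that p² does not divide k·a_p + c_i for every i ∈ {1, …, n}. Then there exists a real number ε > 0 such that for all sufficiently large real x, the number of natural numbers a ≤ x with k·a + c_i squarefree for every i and k·a + c'_j not squarefree for every j is at least ε·x (i.e., the set of such a has positive lower density in ℕ). -/

import Mathlib

lemma card_filter_dvd_linear_le {A B : ℤ} {m : ℕ} (hm : 0 < m) (hA : IsCoprime (m : ℤ) A)
    (T : ℕ) : (((Finset.range T).filter fun t : ℕ => (m : ℤ) ∣ A * t + B).card : ℝ) ≤ T / m + 1 := by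
  rcases Finset.eq_empty_or_nonempty
    ((Finset.range T).filter fun t : ℕ => (m : ℤ) ∣ A * t + B) with h | ⟨v, hv⟩
  · rw [h]; simp; positivity
  have hv' := (Finset.mem_filter.1 hv).2
  have hsub : ((Finset.range T).filter fun t : ℕ => (m : ℤ) ∣ A * t + B) ⊆
      (Finset.range T).filter fun t : ℕ => t ≡ v [MOD m] := by
    intro t ht
    obtain ⟨ht1, ht2⟩ := Finset.mem_filter.1 ht
    refine Finset.mem_filter.2 ⟨ht1, ?_⟩
    refine (Nat.modEq_iff_dvd.2 ?_)
    refine hA.dvd_of_dvd_mul_left (?_ : (m : ℤ) ∣ A * _)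
    have := Int.dvd_sub hv' ht2
    convert this using 1
    ring
  have hcount : ((Finset.range T).filter fun t : ℕ => t ≡ v [MOD m]).card ≤ T / m + 1 := by
    rw [← Nat.count_eq_card_filter_range, Nat.count_modEq_card T hm]
    split_ifs <;> omega
  calc (((Finset.range T).filter fun t : ℕ => (m : ℤ) ∣ A * t + B).card : ℝ)
      ≤ ((T / m + 1 : ℕ) : ℝ) := by exact_mod_cast (Finset.card_le_card hsub).trans hcount
    _ ≤ T / m + 1 := by
        push_cast
        gcongr
        exact Nat.cast_div_le

lemma exists_prime_sq_dvd_of_not_squarefree {z : ℤ} (h : ¬ Squarefree z) :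
    ∃ p : ℕ, p.Prime ∧ (p : ℤ) ^ 2 ∣ z := by
  rw [← Int.squarefree_natAbs, Nat.squarefree_iff_prime_squarefree] at h
  push Not at h
  obtain ⟨p, hp, hd⟩ := h
  refine ⟨p, hp, ?_⟩
  rw [sq]
  exact_mod_cast Int.natCast_dvd.2 hd

open Classical in
lemma card_filter_not_squarefree_linear_le {A B : ℤ} (hA : A ≠ 0) {P : ℕ} (hP : 0 < P)
    (hsmall : ∀ p : ℕ, p.Prime → p ≤ P → ∀ t : ℕ, ¬ (p : ℤ) ^ 2 ∣ A * t + B)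
    (hlarge : ∀ p : ℕ, p.Prime → P < p → ¬ (p : ℤ) ∣ A) (T : ℕ) :
    (((Finset.range T).filter fun t : ℕ => ¬ Squarefree (A * t + B)).card : ℝ) ≤
      1 + T / P + √(A.natAbs * T + B.natAbs) := by
  set Y := Nat.sqrt (A.natAbs * T + B.natAbs) with hY
  set S := (Finset.Ioc P Y).filter Nat.Prime with hS
  have hsub : ((Finset.range T).filter fun t : ℕ => ¬ Squarefree (A * t + B)) ⊆
      ((Finset.range T).filter fun t : ℕ => A * t + B = 0) ∪
        S.biUnion fun p => (Finset.range T).filter fun t : ℕ => ((p ^ 2 : ℕ) : ℤ) ∣ A * t + B := by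
    intro t ht
    obtain ⟨ht1, ht2⟩ := Finset.mem_filter.1 ht
    by_cases h0 : A * t + B = 0
    · exact Finset.mem_union_left _ (Finset.mem_filter.2 ⟨ht1, h0⟩)
    obtain ⟨p, hp, hd⟩ := exists_prime_sq_dvd_of_not_squarefree ht2
    have hPp : P < p := by
      by_contra h
      exact hsmall p hp (not_lt.1 h) t hd
    refine Finset.mem_union_right _ (Finset.mem_biUnion.2 ⟨p, ?_, ?_⟩)
    · refine Finset.mem_filter.2 ⟨Finset.mem_Ioc.2 ⟨hPp, ?_⟩, hp⟩
      rw [hY, Nat.le_sqrt']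
      have h1 : p ^ 2 ≤ (A * t + B).natAbs := by
        have := Int.natAbs_dvd_natAbs.2 hd
        rw [Int.natAbs_pow, Int.natAbs_natCast] at this
        exact Nat.le_of_dvd (Int.natAbs_pos.2 h0) this
      refine h1.trans ((Int.natAbs_add_le _ _).trans ?_)
      rw [Int.natAbs_mul, Int.natAbs_natCast]
      gcongr
      exact (Finset.mem_range.1 ht1).le
    · refine Finset.mem_filter.2 ⟨ht1, ?_⟩
      exact_mod_cast hd
  have hzero : ((Finset.range T).filter fun t : ℕ => A * t + B = 0).card ≤ 1 := by
    refine Finset.card_le_one.2 fun s hs t ht => ?_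
    have h1 := (Finset.mem_filter.1 hs).2
    have h2 := (Finset.mem_filter.1 ht).2
    have : A * (s : ℤ) = A * t := by linarith
    exact_mod_cast mul_left_cancel₀ hA this
  have hp : ∀ p ∈ S, (((Finset.range T).filter fun t : ℕ =>
      ((p ^ 2 : ℕ) : ℤ) ∣ A * t + B).card : ℝ) ≤ T * ((p : ℝ) ^ 2)⁻¹ + 1 := by
    intro p hpS
    obtain ⟨h1, h2⟩ := Finset.mem_filter.1 hpS
    have hcop : IsCoprime ((p ^ 2 : ℕ) : ℤ) A := by
      push_cast
      exact ((Nat.prime_iff_prime_int.1 h2).coprime_iff_not_dvd.2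
        (hlarge p h2 (Finset.mem_Ioc.1 h1).1)).pow_left
    have := card_filter_dvd_linear_le (B := B) (pow_pos h2.pos 2) hcop T
    push_cast at this ⊢
    rwa [div_eq_mul_inv] at this
  have hsum : ∑ p ∈ S, ((T : ℝ) * ((p : ℝ) ^ 2)⁻¹ + 1) ≤ T / P + Y := by
    refine (Finset.sum_le_sum_of_subset_of_nonneg (Finset.filter_subset _ _)
      fun _ _ _ => by positivity).trans ?_
    rw [Finset.sum_add_distrib, ← Finset.mul_sum]
    refine add_le_add ?_ ?_
    · rw [div_eq_mul_inv]
      gcongr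
      rcases le_total P Y with h | h
      · refine (sum_Ioc_inv_sq_le_sub hP.ne' h).trans ?_
        have : (0 : ℝ) ≤ (Y : ℝ)⁻¹ := by positivity
        linarith
      · rw [Finset.Ioc_eq_empty (by omega)]
        simp
    · simp
  have hYr : (Y : ℝ) ≤ √(A.natAbs * T + B.natAbs) := by
    have := Real.nat_sqrt_le_real_sqrt (a := A.natAbs * T + B.natAbs)
    push_cast at this ⊢
    exact this
  calc (((Finset.range T).filter fun t : ℕ => ¬ Squarefree (A * t + B)).card : ℝ)
      ≤ ((1 + ∑ p ∈ S, ((Finset.range T).filter fun t : ℕ =>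
          ((p ^ 2 : ℕ) : ℤ) ∣ A * t + B).card : ℕ) : ℝ) := by
        exact_mod_cast (Finset.card_le_card hsub).trans ((Finset.card_union_le _ _).trans
          (add_le_add hzero Finset.card_biUnion_le))
    _ ≤ 1 + ∑ p ∈ S, ((T : ℝ) * ((p : ℝ) ^ 2)⁻¹ + 1) := by
        push_cast
        gcongr with p hpS
        exact_mod_cast hp p hpS
    _ ≤ _ := by linarith

open Classical in
lemma exists_quarter_le_card_squarefree_linear {n : ℕ} {A : ℤ} (hA : A ≠ 0) (B : Fin n → ℤ)
    {P : ℕ} (hP : 2 * n < P)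
    (hsmall : ∀ p : ℕ, p.Prime → p ≤ P → ∀ i, ∀ t : ℕ, ¬ (p : ℤ) ^ 2 ∣ A * t + B i)
    (hlarge : ∀ p : ℕ, p.Prime → P < p → ¬ (p : ℤ) ∣ A) :
    ∃ T₀ : ℕ, ∀ T : ℕ, T₀ ≤ T → (T : ℝ) / 4 ≤
      (((Finset.range T).filter fun t : ℕ => ∀ i, Squarefree (A * t + B i)).card : ℝ) := by
  obtain ⟨D, hD⟩ : ∃ D : ℕ, ∀ i, (B i).natAbs ≤ D :=
    ⟨∑ i, (B i).natAbs, fun i => Finset.single_le_sum (f := fun i => (B i).natAbs)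
      (fun _ _ => Nat.zero_le _) (Finset.mem_univ i)⟩
  set E : ℕ := A.natAbs + D + 1 with hE
  refine ⟨64 * (n + 1) ^ 2 * E, fun T hT => ?_⟩
  have hE1 : 1 ≤ E := by omega
  have hT1 : 1 ≤ T := le_trans (Nat.succ_le_of_lt (by positivity)) hT
  have hTr : (64 : ℝ) * (n + 1) ^ 2 * E ≤ T := by exact_mod_cast hT
  have hsqrt : ∀ i, 1 + √(A.natAbs * T + (B i).natAbs : ℝ) ≤ 2 * √(E * T : ℝ) := by
    intro i
    have h1 : √(A.natAbs * T + (B i).natAbs : ℝ) ≤ √(E * T : ℝ) := by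
      refine Real.sqrt_le_sqrt ?_
      have : A.natAbs * T + (B i).natAbs ≤ E * T := by
        have := hD i
        rw [hE]
        nlinarith
      exact_mod_cast this
    have h2 : 1 ≤ √(E * T : ℝ) := by
      rw [Real.one_le_sqrt]
      exact_mod_cast Nat.mul_pos hE1 hT1
    linarith
  have hroot : 2 * (n : ℝ) * √(E * T : ℝ) ≤ T / 4 := by
    have : √(E * T : ℝ) ≤ T / (8 * (n + 1)) := by
      refine Real.sqrt_le_iff.2 ⟨by positivity, ?_⟩
      rw [div_pow, le_div_iff₀ (by positivity)]
      have := mul_le_mul_of_nonneg_right hTr (Nat.cast_nonneg (α := ℝ) T)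
      nlinarith
    calc 2 * (n : ℝ) * √(E * T : ℝ) ≤ 2 * (n + 1) * (T / (8 * (n + 1))) := by
          gcongr
          linarith
      _ = T / 4 := by field_simp; norm_num
  have hbad : (((Finset.range T).filter fun t : ℕ => ¬ ∀ i, Squarefree (A * t + B i)).card : ℝ) ≤
      ∑ i : Fin n, (((Finset.range T).filter fun t : ℕ => ¬ Squarefree (A * t + B i)).card : ℝ) := by
    have : ((Finset.range T).filter fun t : ℕ => ¬ ∀ i, Squarefree (A * t + B i)) ⊆
        Finset.univ.biUnion fun i : Fin n =>
          (Finset.range T).filter fun t : ℕ => ¬ Squarefree (A * t + B i) := by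
      intro t ht
      simpa using ht
    exact_mod_cast (Finset.card_le_card this).trans Finset.card_biUnion_le
  have hbound : ∑ i : Fin n,
      (((Finset.range T).filter fun t : ℕ => ¬ Squarefree (A * t + B i)).card : ℝ) ≤
      n * (T / P + 2 * √(E * T : ℝ)) := by
    refine (Finset.sum_le_card_nsmul _ _ (T / P + 2 * √(E * T : ℝ)) fun i _ => ?_).trans ?_
    · have := card_filter_not_squarefree_linear_le hA (by omega)
        (fun p hp h => hsmall p hp h i) hlarge T
      linarith [hsqrt i]
    · rw [Finset.card_univ, Fintype.card_fin, nsmul_eq_mul]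
  have hhalf : (n : ℝ) * (T / P) ≤ T / 2 := by
    have hP' : (2 * n : ℝ) ≤ P := by exact_mod_cast hP.le
    have hP0 : (0 : ℝ) < P := by exact_mod_cast (by omega : 0 < P)
    rw [← mul_div_assoc, div_le_div_iff₀ hP0 two_pos]
    nlinarith [Nat.cast_nonneg (α := ℝ) T]
  have htot : (((Finset.range T).filter fun t : ℕ => ∀ i, Squarefree (A * t + B i)).card : ℝ) +
      ((Finset.range T).filter fun t : ℕ => ¬ ∀ i, Squarefree (A * t + B i)).card = T := by
    have := Finset.card_filter_add_card_filter_not (s := Finset.range T)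
      (fun t : ℕ => ∀ i, Squarefree (A * t + B i))
    rw [Finset.card_range] at this
    exact_mod_cast this
  nlinarith

lemma exists_local_residues {k : ℤ} (hk : k ≠ 0) {n n' : ℕ} {c : Fin n → ℤ} {c' : Fin n' → ℤ}
    (hdist : ∀ i j, c i ≠ c' j)
    (hloc : ∀ p : ℕ, p.Prime → ∃ a : ℤ, ∀ i : Fin n, ¬ ((p : ℤ) ^ 2 ∣ k * a + c i)) :
    ∃ (b : ℕ → ℤ) (q : Fin n' → ℕ),
      (∀ p : ℕ, p.Prime → ∀ i, ¬ (p : ℤ) ^ 2 ∣ k * b p + c i) ∧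
      (∀ j, (q j).Prime ∧ (q j : ℤ) ^ 2 ∣ k * b (q j) + c' j) := by
  set N : ℕ := k.natAbs + (∑ i, ∑ j, (c i - c' j).natAbs) + 1 with hN
  set q : Fin n' → ℕ := fun j => Nat.nth Nat.Prime (N + j) with hq
  have hqp : ∀ j, (q j).Prime := fun j => Nat.prime_nth_prime _
  have hqN : ∀ j, N ≤ q j := fun j =>
    (Nat.le_add_right _ _).trans (Nat.nth_strictMono Nat.infinite_setOfPred_prime).le_apply
  have hqinj : Function.Injective q := fun j j' h => by
    have := Nat.nth_injective Nat.infinite_setOfPred_prime h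
    exact Fin.ext (by omega)
  have hcN : ∀ i j, (c i - c' j).natAbs < N := fun i j => by
    have h1 := Finset.single_le_sum (f := fun j => (c i - c' j).natAbs)
      (fun _ _ => Nat.zero_le _) (Finset.mem_univ j)
    have h2 := Finset.single_le_sum (f := fun i => ∑ j, (c i - c' j).natAbs)
      (fun _ _ => Nat.zero_le _) (Finset.mem_univ i)
    omega
  have hsolve : ∀ j, ∃ a : ℤ, (q j : ℤ) ^ 2 ∣ k * a + c' j := fun j => by
    have hcop : IsCoprime ((q j : ℤ) ^ 2) k := by
      refine ((Nat.prime_iff_prime_int.1 (hqp j)).coprime_iff_not_dvd.2 fun h => ?_).pow_left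
      have := Nat.le_of_dvd (Int.natAbs_pos.2 hk) (Int.natCast_dvd.1 h)
      have := hqN j
      omega
    obtain ⟨u, v, huv⟩ := hcop
    exact ⟨-v * c' j, u * c' j, by linear_combination (-c' j) * huv⟩
  have hex : ∀ p : ℕ, ∃ a : ℤ, (p.Prime → ∀ i, ¬ (p : ℤ) ^ 2 ∣ k * a + c i) ∧
      ∀ j, q j = p → (q j : ℤ) ^ 2 ∣ k * a + c' j := by
    intro p
    by_cases hpq : ∃ j, q j = p
    · obtain ⟨j, rfl⟩ := hpq
      obtain ⟨a, ha⟩ := hsolve j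
      refine ⟨a, fun _ i hi => ?_, fun j' hj' => hqinj hj' ▸ ha⟩
      have hd : (q j : ℤ) ^ 2 ∣ c i - c' j := by
        convert Int.dvd_sub hi ha using 1
        ring
      have h1 := Nat.le_of_dvd (Int.natAbs_pos.2 (sub_ne_zero.2 (hdist i j)))
        (Int.natCast_dvd.1 ((dvd_pow_self _ two_ne_zero).trans hd))
      have := hqN j
      have := hcN i j
      omega
    · by_cases hp : p.Prime
      · obtain ⟨a, ha⟩ := hloc p hp
        exact ⟨a, fun _ => ha, fun j hj => (hpq ⟨j, hj⟩).elim⟩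
      · exact ⟨0, fun h => (hp h).elim, fun j hj => (hpq ⟨j, hj⟩).elim⟩
  choose b hb hb' using hex
  exact ⟨b, q, hb, fun j => ⟨hqp j, hb' _ j rfl⟩⟩

lemma exists_nat_forall_prime_sq_dvd_sub (b : ℕ → ℤ) (P : ℕ) :
    ∃ r : ℕ, ∀ p ∈ (P + 1).primesBelow, (p : ℤ) ^ 2 ∣ r - b p := by
  have hpr : ∀ p ∈ (P + 1).primesBelow, p.Prime := fun p hp => Nat.prime_of_mem_primesBelow hp
  obtain ⟨r, hr⟩ := Nat.chineseRemainderOfFinset (fun p => (b p % (p : ℤ) ^ 2).toNat)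
    (fun p => p ^ 2) (P + 1).primesBelow (fun p hp => pow_ne_zero 2 (hpr p hp).ne_zero)
    (fun p hp p' hp' hne => Nat.Coprime.pow 2 2 ((Nat.coprime_primes (hpr p hp) (hpr p' hp')).2 hne))
  refine ⟨r, fun p hp => ?_⟩
  have h1 := (Nat.modEq_iff_dvd.1 (hr p hp).symm)
  have h0 : (p : ℤ) ^ 2 ≠ 0 := pow_ne_zero 2 (by exact_mod_cast (hpr p hp).ne_zero)
  rw [Int.toNat_of_nonneg (Int.emod_nonneg _ h0)] at h1
  push_cast at h1
  have h2 : (p : ℤ) ^ 2 ∣ b p % (p : ℤ) ^ 2 - b p := (Int.mod_modEq _ _).symm.dvd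
  convert Int.dvd_add h1 h2 using 1
  ring

/-- Under local satisfiability, the set of natural numbers `a` such that every
`k * a + c i` is squarefree and every `k * a + c' j` is not squarefree has positive
lower density: there is `ε > 0` such that for all sufficiently large real `x`, the
number of such `a ≤ x` is at least `ε x`. -/
theorem int_system_solutions_positive_lower_density
    (k : ℤ) (hk : k ≠ 0) (n n' : ℕ) (c : Fin n → ℤ) (c' : Fin n' → ℤ)
    (hdist : Function.Injective (Sum.elim c c'))
    (hloc : ∀ p : ℕ, p.Prime → ∃ a : ℤ, ∀ i : Fin n, ¬ ((p : ℤ) ^ 2 ∣ k * a + c i)) :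
    ∃ ε : ℝ, 0 < ε ∧ ∃ x₀ : ℝ, ∀ x : ℝ, x₀ ≤ x →
      ε * x ≤ ({a : ℕ | (a : ℝ) ≤ x ∧
          (∀ i : Fin n, Squarefree (k * (a : ℤ) + c i)) ∧
          (∀ j : Fin n', ¬ Squarefree (k * (a : ℤ) + c' j))}.ncard : ℝ) := by
  classical
  obtain ⟨b, q, hb, hq⟩ := exists_local_residues (c := c) (c' := c') hk
    (fun i j h => Sum.inl_ne_inr (hdist (a₁ := Sum.inl i) (a₂ := Sum.inr j) h)) hloc
  set P : ℕ := 2 * n + 1 + k.natAbs + ∑ j, q j with hP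
  have hqP : ∀ j, q j ≤ P := fun j => by
    have := Finset.single_le_sum (f := q) (fun _ _ => Nat.zero_le _) (Finset.mem_univ j)
    omega
  obtain ⟨r, hr⟩ := exists_nat_forall_prime_sq_dvd_sub b P
  set M : ℕ := ∏ p ∈ (P + 1).primesBelow, p ^ 2 with hM
  have hM0 : 0 < M :=
    Finset.prod_pos fun p hp => pow_pos (Nat.prime_of_mem_primesBelow hp).pos 2
  have hdvd : ∀ p : ℕ, p.Prime → p ≤ P → ∀ t : ℕ, (p : ℤ) ^ 2 ∣ ((r + M * t : ℕ) : ℤ) - b p := by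
    intro p hp hpP t
    have hmem : p ∈ (P + 1).primesBelow := Nat.mem_primesBelow.2 ⟨by omega, hp⟩
    have h1 : (p : ℤ) ^ 2 ∣ M := by exact_mod_cast Finset.dvd_prod_of_mem (fun p => p ^ 2) hmem
    have := Int.dvd_add (hr p hmem) (h1.mul_right (t : ℤ))
    convert this using 1
    push_cast
    ring
  have hA : k * (M : ℤ) ≠ 0 := mul_ne_zero hk (by exact_mod_cast hM0.ne')
  have hsmall : ∀ p : ℕ, p.Prime → p ≤ P → ∀ i, ∀ t : ℕ,
      ¬ (p : ℤ) ^ 2 ∣ k * M * t + (k * r + c i) := by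
    intro p hp hpP i t h
    refine hb p hp i ?_
    convert Int.dvd_sub h ((hdvd p hp hpP t).mul_left k) using 1
    push_cast
    ring
  have hlarge : ∀ p : ℕ, p.Prime → P < p → ¬ (p : ℤ) ∣ k * M := by
    intro p hp hpP h
    rcases (Nat.prime_iff_prime_int.1 hp).dvd_or_dvd h with h | h
    · have := Nat.le_of_dvd (Int.natAbs_pos.2 hk) (Int.natCast_dvd.1 h)
      omega
    · obtain ⟨p', hp', hd⟩ := (hp.prime.dvd_finsetProd_iff _).1 (Int.natCast_dvd_natCast.1 h)
      have := Nat.le_of_dvd (Nat.prime_of_mem_primesBelow hp').pos (hp.dvd_of_dvd_pow hd)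
      have := Nat.lt_of_mem_primesBelow hp'
      omega
  obtain ⟨T₀, hT₀⟩ := exists_quarter_le_card_squarefree_linear hA (fun i => k * r + c i)
    (by omega) hsmall hlarge
  have hrM : (0 : ℝ) < r + M := by
    have : (0 : ℝ) < M := by exact_mod_cast hM0
    positivity
  refine ⟨1 / (8 * (r + M)), by positivity, (T₀ + 2) * (r + M), fun x hx => ?_⟩
  rw [← le_div_iff₀ hrM] at hx
  have hx0 : 0 ≤ x / (r + M) := le_trans (by positivity) hx
  set T := ⌊x / (r + M)⌋₊ with hT
  have hT0 : T₀ ≤ T := Nat.le_floor (by linarith)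
  have hTx : (T : ℝ) ≤ x / (r + M) := Nat.floor_le hx0
  have hxT : x / (r + M) < T + 1 := Nat.lt_floor_add_one _
  have hT2 : (2 : ℝ) ≤ x / (r + M) := le_trans (by linarith [Nat.cast_nonneg (α := ℝ) T₀]) hx
  have hinj : Function.Injective fun t : ℕ => r + M * t := fun s t h =>
    Nat.eq_of_mul_eq_mul_left hM0 (Nat.add_left_cancel h)
  have hcard : ((Finset.range T).filter fun t : ℕ =>
        ∀ i, Squarefree (k * M * t + (k * r + c i))).card ≤
      {a : ℕ | (a : ℝ) ≤ x ∧ (∀ i : Fin n, Squarefree (k * (a : ℤ) + c i)) ∧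
        (∀ j : Fin n', ¬ Squarefree (k * (a : ℤ) + c' j))}.ncard := by
    rw [← Finset.card_image_of_injective _ hinj, ← Set.ncard_coe_finset]
    refine Set.ncard_le_ncard ?_
      ((Set.finite_Iic ⌊x⌋₊).subset fun a ha => Nat.le_floor ha.1)
    intro a ha
    obtain ⟨t, ht, rfl⟩ := Finset.mem_image.1 (Finset.mem_coe.1 ha)
    obtain ⟨ht1, ht2⟩ := Finset.mem_filter.1 ht
    refine ⟨?_, fun i => ?_, fun j hj => ?_⟩
    · have htT : (t : ℝ) + 1 ≤ T := by exact_mod_cast Finset.mem_range.1 ht1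
      have h1 := (le_div_iff₀ hrM).1 (htT.trans hTx)
      have h2 : (0 : ℝ) ≤ t * r := by positivity
      have h3 : (0 : ℝ) ≤ M := Nat.cast_nonneg M
      push_cast
      linarith
    · convert ht2 i using 1
      push_cast
      ring
    · obtain ⟨hqp, hqd⟩ := hq j
      have h1 : (q j : ℤ) * q j ∣ k * ((r + M * t : ℕ) : ℤ) + c' j := by
        rw [← sq]
        convert Int.dvd_add hqd ((hdvd _ hqp (hqP j) t).mul_left k) using 1
        ring
      exact (Nat.prime_iff_prime_int.1 hqp).not_isUnit (hj _ h1)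
  calc 1 / (8 * (r + M)) * x = x / (r + M) / 8 := by field_simp
    _ ≤ (T : ℝ) / 4 := by linarith
    _ ≤ _ := (hT₀ T hT0).trans (by exact_mod_cast hcard)
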